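/- Let p be a prime and let φ : ℚ_p → ℂ be a locally constant, compactly supported function (a test function) such that ∫_{ℚ_p} φ(x) dx ≠ 0, the system of translates {φ(·−a) : a ∈ I_p} is orthonormal in L²(ℚ_p), and the spaces V_j(φ), j ∈ ℤ, form a multiresolution analysis in L²(ℚ_p) (i.e., φ is an orthogonal scaling function). Then φ is 1-periodic: φ(x+y) = φ(x) for every x ∈ ℚ_p and every y ∈ ℚ_p with |y|_p ≤ 1. -/

import Mathlib

open scoped Classical

open MeasureTheory

noncomputable instance (p : ℕ) [Fact p.Prime] : MeasurableSpace ℚ_[p] := borel _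
instance (p : ℕ) [Fact p.Prime] : BorelSpace ℚ_[p] := ⟨rfl⟩

/-- The Haar measure on `ℚ_[p]`, normalized so that the unit ball `ℤ_p` has measure 1. -/
noncomputable def padicHaar (p : ℕ) [Fact p.Prime] : Measure ℚ_[p] :=
  Measure.addHaarMeasure
    ⟨⟨Metric.closedBall 0 1, isCompact_closedBall 0 1⟩,
      ⟨0, Metric.ball_subset_interior_closedBall (Metric.mem_ball_self one_pos)⟩⟩

/-- The natural set of shifts `I_p ⊆ ℚ_p`. -/
def Ip (p : ℕ) [Fact p.Prime] : Set ℚ_[p] :=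
  {a | ∃ γ k : ℕ, k < p ^ γ ∧ a = (k : ℚ_[p]) * (p : ℚ_[p]) ^ (-(γ : ℤ))}

/-- `V_j(φ)`: the closed linear span of `x ↦ φ(p^{-j} x - a)`, `a ∈ I_p`, inside `L²(ℚ_p)`. -/
noncomputable def Vspace (p : ℕ) [Fact p.Prime] (φ : ℚ_[p] → ℂ) (j : ℤ) :
    Submodule ℂ (Lp ℂ 2 (padicHaar p)) :=
  (Submodule.span ℂ {f : Lp ℂ 2 (padicHaar p) |
    ∃ a ∈ Ip p, (f : ℚ_[p] → ℂ) =ᵐ[padicHaar p]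
      fun x => φ ((p : ℚ_[p]) ^ (-j) * x - a)}).topologicalClosure

theorem mem_of_mem_topologicalClosure_span {E : Type*} [NormedAddCommGroup E]
    [InnerProductSpace ℂ E] (F : Submodule ℂ E) [F.HasOrthogonalProjection] (S : Set E) {v : E}
    (hv : v ∈ (Submodule.span ℂ S).topologicalClosure)
    (hS : ∀ g ∈ S, g ∈ F ∨ (g ∈ Fᗮ ∧ inner ℂ g v = 0)) : v ∈ F := by
  have hu : v - F.starProjection v ∈ Fᗮ := F.sub_starProjection_mem_orthogonal v
  have hPv : F.starProjection v ∈ F := F.starProjection_apply_mem v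
  have hle : Submodule.span ℂ S ≤ (ℂ ∙ (v - F.starProjection v))ᗮ := by
    refine Submodule.span_le.2 fun g hg => ?_
    rw [SetLike.mem_coe, Submodule.mem_orthogonal_singleton_iff_inner_left]
    rcases hS g hg with h | ⟨h, h'⟩
    · exact hu g h
    · rw [inner_sub_right, h', Submodule.inner_left_of_mem_orthogonal hPv h, sub_zero]
  have h1 : v ∈ (ℂ ∙ (v - F.starProjection v))ᗮ :=
    Submodule.topologicalClosure_minimal _ hle (Submodule.isClosed_orthogonal _) hv
  rw [Submodule.mem_orthogonal_singleton_iff_inner_left] at h1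
  have h2 : inner ℂ (v - F.starProjection v) (v - F.starProjection v) = 0 := by
    rw [inner_sub_left, h1, hu _ hPv, sub_zero]
  rw [inner_self_eq_zero, sub_eq_zero] at h2
  rw [h2]
  exact hPv

theorem inner_eq_zero_of_ae_eq_zero_or {α : Type*} [MeasurableSpace α] {μ : Measure α}
    (f g : Lp ℂ 2 μ) (h : ∀ᵐ x ∂μ, f x = 0 ∨ g x = 0) : inner ℂ f g = 0 := by
  rw [L2.inner_def]
  refine integral_eq_zero_of_ae ?_
  filter_upwards [h] with x hx
  rcases hx with hx | hx <;> simp [hx]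

theorem sum_range_mul_eq {M : Type*} [AddCommMonoid M] (f : ℕ → M) (a b : ℕ) :
    ∑ k ∈ Finset.range (a * b), f k
      = ∑ q ∈ Finset.range b, ∑ r ∈ Finset.range a, f (a * q + r) := by
  induction b with
  | zero => simp
  | succ b ih => rw [mul_add_one, Finset.sum_range_add, ih, Finset.sum_range_succ]

section Padic

variable {p : ℕ} [Fact p.Prime]

instance : (padicHaar p).IsAddHaarMeasure := by
  unfold padicHaar; infer_instance

theorem one_lt_prime_cast : (1 : ℝ) < p := by
  exact_mod_cast (Fact.out : p.Prime).one_lt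

theorem prime_cast_padic_ne_zero : (p : ℚ_[p]) ≠ 0 := by
  exact_mod_cast (Fact.out : p.Prime).ne_zero

theorem lt_norm_sub_of_le_of_lt {x y : ℚ_[p]} {r : ℝ} (hx : ‖x‖ ≤ r) (hy : r < ‖y‖) :
    r < ‖x - y‖ := by
  by_contra! h
  have := Padic.nonarchimedean (x - y) (-x)
  rw [norm_neg, show x - y + -x = -y by ring, norm_neg] at this
  exact absurd (this.trans (max_le h hx)) (not_le.2 hy)

theorem exists_eq_natCast_mul_of_mem_Ip {a : ℚ_[p]} (ha : a ∈ Ip p) {m : ℕ}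
    (hm : ‖a‖ ≤ (p : ℝ) ^ m) : ∃ k < p ^ m, a = (k : ℚ_[p]) * (p : ℚ_[p]) ^ (-(m : ℤ)) := by
  have hp := prime_cast_padic_ne_zero (p := p)
  have hp0 : (0 : ℝ) < p := zero_lt_one.trans one_lt_prime_cast
  have hpp : 0 < p := (Fact.out : p.Prime).pos
  obtain ⟨γ, k, hk, rfl⟩ := ha
  rcases le_total γ m with h | h
  · obtain ⟨d, rfl⟩ := Nat.exists_eq_add_of_le h
    refine ⟨k * p ^ d, ?_, ?_⟩
    · rw [pow_add]
      exact Nat.mul_lt_mul_of_pos_right hk (pow_pos hpp d)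
    · push_cast
      rw [neg_add, zpow_add₀ hp, zpow_neg _ (d : ℤ), zpow_natCast _ d]
      field_simp
  · obtain ⟨d, rfl⟩ := Nat.exists_eq_add_of_le h
    have hdvd : ((p ^ d : ℕ) : ℤ) ∣ (k : ℤ) := by
      rw [Nat.cast_pow, ← Padic.norm_int_le_pow_iff_dvd (p := p)]
      rw [norm_mul, Padic.norm_p_zpow, neg_neg, zpow_natCast, pow_add] at hm
      rw [zpow_neg, zpow_natCast, Int.cast_natCast]
      rw [← one_div, le_div_iff₀ (by positivity)]
      refine le_of_mul_le_mul_left ?_ (show (0 : ℝ) < (p : ℝ) ^ m by positivity)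
      linarith
    obtain ⟨k', rfl⟩ := Int.natCast_dvd_natCast.1 hdvd
    refine ⟨k', ?_, ?_⟩
    · rw [pow_add, mul_comm] at hk
      exact Nat.lt_of_mul_lt_mul_right hk
    · push_cast
      rw [neg_add, zpow_add₀ hp, zpow_neg _ (d : ℤ), zpow_natCast _ d]
      field_simp

theorem exists_pos_forall_norm_lt_add_eq {φ : ℚ_[p] → ℂ}
    (hlc : ∀ x : ℚ_[p], ∃ γ : ℤ, ∀ y : ℚ_[p], ‖y‖ ≤ (p : ℝ) ^ γ → φ (x + y) = φ x) {N : ℕ}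
    (hN : ∀ x : ℚ_[p], (p : ℝ) ^ N < ‖x‖ → φ x = 0) :
    ∃ δ > 0, ∀ x y : ℚ_[p], ‖y‖ < δ → φ (x + y) = φ x := by
  have hp0 : (0 : ℝ) < p := zero_lt_one.trans one_lt_prime_cast
  have hopen : ∀ i : ℂ, IsOpen (φ ⁻¹' {i}) := by
    intro i
    rw [Metric.isOpen_iff]
    rintro x hx
    obtain ⟨γ, hγ⟩ := hlc x
    refine ⟨(p : ℝ) ^ γ, zpow_pos hp0 γ, fun z hz => ?_⟩
    have := hγ (z - x) (by rw [← dist_eq_norm]; exact (Metric.mem_ball.1 hz).le)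
    rw [add_sub_cancel] at this
    simpa [this] using hx
  obtain ⟨δ, hδ, H⟩ := lebesgue_number_lemma_of_metric
    (isCompact_closedBall (0 : ℚ_[p]) ((p : ℝ) ^ N)) hopen
    (fun x _ => Set.mem_iUnion.2 ⟨φ x, rfl⟩)
  have key : ∀ x y : ℚ_[p], ‖x‖ ≤ (p : ℝ) ^ N → ‖y‖ < δ → φ (x + y) = φ x := by
    intro x y hx hy
    obtain ⟨i, hi⟩ := H x (by simpa using hx)
    have h1 : φ x = i := hi (Metric.mem_ball_self hδ)
    have h2 : φ (x + y) = i := hi (by simpa using hy)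
    rw [h1, h2]
  refine ⟨δ, hδ, fun x y hy => ?_⟩
  by_cases hx : ‖x‖ ≤ (p : ℝ) ^ N
  · exact key x y hx hy
  by_cases hxy : ‖x + y‖ ≤ (p : ℝ) ^ N
  · have := key (x + y) (-y) hxy (by rwa [norm_neg])
    rw [add_neg_cancel_right] at this
    exact this.symm
  · rw [hN _ (not_le.1 hx), hN _ (not_le.1 hxy)]

theorem continuous_of_forall_norm_lt_add_eq {φ : ℚ_[p] → ℂ} {δ : ℝ} (hδ : 0 < δ)
    (h : ∀ x y : ℚ_[p], ‖y‖ < δ → φ (x + y) = φ x) : Continuous φ := by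
  refine Metric.continuous_iff.2 fun x ε hε => ⟨δ, hδ, fun z hz => ?_⟩
  have := h x (z - x) (by rwa [← dist_eq_norm])
  rw [add_sub_cancel] at this
  rwa [this, dist_self]

theorem hasCompactSupport_of_forall_lt_norm {φ : ℚ_[p] → ℂ} {R : ℝ}
    (h : ∀ x : ℚ_[p], R < ‖x‖ → φ x = 0) : HasCompactSupport φ :=
  HasCompactSupport.intro (isCompact_closedBall 0 R) fun x hx => h x (by simpa using hx)

theorem memLp_comp_mul_sub {φ : ℚ_[p] → ℂ} (hφ : Continuous φ) (hs : HasCompactSupport φ)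
    {c : ℚ_[p]} (hc : c ≠ 0) (a : ℚ_[p]) :
    MemLp (fun x => φ (c * x - a)) 2 (padicHaar p) :=
  Continuous.memLp_of_hasCompactSupport (by fun_prop)
    (hs.comp_homeomorph ((Homeomorph.mulLeft₀ c hc).trans (Homeomorph.subRight a)))

/-- Membership in `V_j(φ)` of a function supported in a ball only involves finitely many shifts. -/
theorem exists_sum_of_mem_Vspace {φ : ℚ_[p] → ℂ} (hφ : Continuous φ) {N : ℕ}
    (hN : ∀ x : ℚ_[p], (p : ℝ) ^ N < ‖x‖ → φ x = 0) (j : ℕ) {f : Lp ℂ 2 (padicHaar p)}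
    (hf : f =ᵐ[padicHaar p] φ) (hmem : f ∈ Vspace p φ j) :
    ∃ c : ℕ → ℂ, ∀ x, φ x = ∑ k ∈ Finset.range (p ^ (N + j)),
      c k * φ ((p : ℚ_[p]) ^ (-(j : ℤ)) * x
        - (k : ℚ_[p]) * (p : ℚ_[p]) ^ (-((N + j : ℕ) : ℤ))) := by
  have hp := prime_cast_padic_ne_zero (p := p)
  have hp0 : (0 : ℝ) < p := zero_lt_one.trans one_lt_prime_cast
  have hs := hasCompactSupport_of_forall_lt_norm hN
  set s : ℚ_[p] := (p : ℚ_[p]) ^ (-(j : ℤ)) with hs_def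
  have hs0 : s ≠ 0 := zpow_ne_zero _ hp
  have hsn : ‖s‖ = (p : ℝ) ^ j := by
    rw [hs_def, Padic.norm_p_zpow, neg_neg, zpow_natCast]
  set b : ℕ → ℚ_[p] := fun k => (k : ℚ_[p]) * (p : ℚ_[p]) ^ (-((N + j : ℕ) : ℤ)) with hb
  have hbn : ∀ k, ‖b k‖ ≤ (p : ℝ) ^ (N + j) := by
    intro k
    rw [hb]
    simp only [norm_mul, Padic.norm_p_zpow, neg_neg, zpow_natCast]
    exact mul_le_of_le_one_left (by positivity)
      (by simpa using Padic.norm_int_le_one (p := p) k)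
  set v : ℕ → Lp ℂ 2 (padicHaar p) := fun k => (memLp_comp_mul_sub hφ hs hs0 (b k)).toLp with hv
  have hvae : ∀ k, v k =ᵐ[padicHaar p] fun x => φ (s * x - b k) := fun k => MemLp.coeFn_toLp _
  have hvz : ∀ k x, (p : ℝ) ^ N < ‖x‖ → φ (s * x - b k) = 0 := by
    intro k x hx
    refine hN _ ?_
    have h1 : (p : ℝ) ^ (N + j) < ‖s * x‖ := by
      rw [norm_mul, hsn, pow_add, mul_comm]
      exact mul_lt_mul_of_pos_left hx (by positivity)
    have h2 := lt_norm_sub_of_le_of_lt (hbn k) h1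
    rw [norm_sub_rev] at h2
    exact (pow_le_pow_right₀ one_lt_prime_cast.le (Nat.le_add_right N j)).trans_lt h2
  set F : Submodule ℂ (Lp ℂ 2 (padicHaar p)) :=
    Submodule.span ℂ (v '' (Finset.range (p ^ (N + j)) : Set ℕ)) with hF
  have : FiniteDimensional ℂ F :=
    FiniteDimensional.span_of_finite ℂ ((Finset.finite_toSet _).image v)
  have hfF : f ∈ F := by
    refine mem_of_mem_topologicalClosure_span F _ hmem ?_
    rintro g ⟨a, ha, hg⟩
    by_cases han : ‖a‖ ≤ (p : ℝ) ^ (N + j)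
    · left
      obtain ⟨k, hk, rfl⟩ := exists_eq_natCast_mul_of_mem_Ip ha han
      have : g = v k := Lp.ext (hg.trans (hvae k).symm)
      rw [this]
      exact Submodule.subset_span ⟨k, by simpa using hk, rfl⟩
    · right
      rw [not_le] at han
      have hgz : ∀ x, ‖x‖ ≤ (p : ℝ) ^ N → φ (s * x - a) = 0 := by
        intro x hx
        refine hN _ ?_
        have h1 : ‖s * x‖ ≤ (p : ℝ) ^ (N + j) := by
          rw [norm_mul, hsn, pow_add, mul_comm]
          exact mul_le_mul_of_nonneg_right hx (by positivity)
        exact (pow_le_pow_right₀ one_lt_prime_cast.le (Nat.le_add_right N j)).trans_lt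
          (lt_norm_sub_of_le_of_lt h1 han)
      constructor
      · have hle : F ≤ (ℂ ∙ g)ᗮ := by
          refine Submodule.span_le.2 ?_
          rintro _ ⟨k, -, rfl⟩
          rw [SetLike.mem_coe, Submodule.mem_orthogonal_singleton_iff_inner_left]
          refine inner_eq_zero_of_ae_eq_zero_or _ _ ?_
          filter_upwards [hvae k, hg] with x h1 h2
          rw [h1, h2]
          rcases le_or_gt ‖x‖ ((p : ℝ) ^ N) with h | h
          · exact Or.inr (hgz x h)
          · exact Or.inl (hvz k x h)
        exact fun u hu => Submodule.mem_orthogonal_singleton_iff_inner_left.1 (hle hu)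
      · refine inner_eq_zero_of_ae_eq_zero_or _ _ ?_
        filter_upwards [hf, hg] with x h1 h2
        rw [h1, h2]
        rcases le_or_gt ‖x‖ ((p : ℝ) ^ N) with h | h
        · exact Or.inl (hgz x h)
        · exact Or.inr (hN x h)
  obtain ⟨c, hc⟩ : ∃ c : ℕ → ℂ, ∑ k ∈ Finset.range (p ^ (N + j)), c k • v k = f := by
    obtain ⟨c, hc⟩ := (Submodule.mem_span_image_finset_iff_exists_fun ℂ).1 hfF
    refine ⟨Function.extend Subtype.val c 0, ?_⟩
    rw [← Finset.sum_coe_sort, ← hc]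
    exact Finset.sum_congr rfl fun k _ => by rw [Subtype.val_injective.extend_apply]
  refine ⟨c, fun x => ?_⟩
  have hsum : (∑ k ∈ Finset.range (p ^ (N + j)), c k • v k : Lp ℂ 2 (padicHaar p))
      =ᵐ[padicHaar p] fun x => ∑ k ∈ Finset.range (p ^ (N + j)), c k * φ (s * x - b k) := by
    refine (Lp.coeFn_finsetSum _ _).trans ?_
    have h1 : ∀ᵐ x ∂(padicHaar p), ∀ k, (c k • v k : Lp ℂ 2 (padicHaar p)) x
        = c k * φ (s * x - b k) := by
      refine ae_all_iff.2 fun k => ?_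
      filter_upwards [Lp.coeFn_smul (c k) (v k), hvae k] with x h1 h2
      rw [h1, Pi.smul_apply, h2, smul_eq_mul]
    filter_upwards [h1] with x hx
    simp only [Finset.sum_apply]
    exact Finset.sum_congr rfl fun k _ => hx k
  rw [hc] at hsum
  have := (Continuous.ae_eq_iff_eq (padicHaar p) hφ (by fun_prop)).1 (hf.symm.trans hsum)
  exact congrFun this x

/-- If the fine shifts `φ(· - k p^{-(N+j)})`, `k < p^j (p^N + 1)`, of a function supported in the
ball of radius `p^N` are linearly dependent, so are the shifts `φ(· - q p^{-N})`, `q ≤ p^N`. -/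
theorem exists_coarse_relation {φ : ℚ_[p] → ℂ} {N j : ℕ}
    (hN : ∀ x : ℚ_[p], (p : ℝ) ^ N < ‖x‖ → φ x = 0) {P : ℕ → ℂ}
    (hP : ∃ k < p ^ j * (p ^ N + 1), P k ≠ 0)
    (hrel : ∀ y, ∑ k ∈ Finset.range (p ^ j * (p ^ N + 1)),
      P k * φ (y - (k : ℚ_[p]) * (p : ℚ_[p]) ^ (-((N + j : ℕ) : ℤ))) = 0) :
    ∃ b : ℕ → ℂ, (∃ q < p ^ N + 1, b q ≠ 0) ∧ ∀ z, ∑ q ∈ Finset.range (p ^ N + 1),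
      b q * φ (z - (q : ℚ_[p]) * (p : ℚ_[p]) ^ (-(N : ℤ))) = 0 := by
  have hp := prime_cast_padic_ne_zero (p := p)
  have hp0 : (0 : ℝ) < p := zero_lt_one.trans one_lt_prime_cast
  have hpj : 0 < p ^ j := pow_pos (Fact.out : p.Prime).pos j
  obtain ⟨k₀, hk₀, hPk₀⟩ := hP
  have hr : k₀ % p ^ j < p ^ j := Nat.mod_lt _ hpj
  set r := k₀ % p ^ j with hr_def
  refine ⟨fun q => P (p ^ j * q + r), ⟨k₀ / p ^ j, Nat.div_lt_of_lt_mul hk₀, ?_⟩, fun z => ?_⟩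
  · simpa only [hr_def, Nat.div_add_mod] using hPk₀
  have hscale : (p : ℚ_[p]) ^ j * (p : ℚ_[p]) ^ (-((N + j : ℕ) : ℤ))
      = (p : ℚ_[p]) ^ (-(N : ℤ)) := by
    rw [← zpow_natCast, ← zpow_add₀ hp]
    congr 1
    push_cast
    ring
  have hqn : ∀ q : ℕ, ‖(q : ℚ_[p]) * (p : ℚ_[p]) ^ (-(N : ℤ))‖ ≤ (p : ℝ) ^ N := by
    intro q
    simp only [norm_mul, Padic.norm_p_zpow, neg_neg, zpow_natCast]
    exact mul_le_of_le_one_left (by positivity)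
      (by simpa using Padic.norm_int_le_one (p := p) q)
  rcases le_or_gt ‖z‖ ((p : ℝ) ^ N) with hz | hz
  · rw [← hrel (z + (r : ℚ_[p]) * (p : ℚ_[p]) ^ (-((N + j : ℕ) : ℤ))), sum_range_mul_eq]
    refine Finset.sum_congr rfl fun q _ => ?_
    rw [Finset.sum_eq_single r]
    · congr 2
      rw [← hscale]
      push_cast
      ring
    · intro r' hr' hne
      rw [Finset.mem_range] at hr'
      rw [hN _ ?_, mul_zero]
      have hlt : (p : ℝ) ^ N < ‖((p ^ j * q + r' : ℤ) - r : ℤ) *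
          (p : ℚ_[p]) ^ (-((N + j : ℕ) : ℤ))‖ := by
        have hnd : ¬ ((p ^ j : ℕ) : ℤ) ∣ ((p ^ j * q + r' : ℤ) - r) := by
          intro hd
          rw [← Int.modEq_iff_dvd] at hd
          have h3 : (r : ℤ) ≡ r' [ZMOD ((p ^ j : ℕ) : ℤ)] := by
            refine hd.trans ?_
            simp [Int.ModEq]
          rw [Int.natCast_modEq_iff] at h3
          exact hne (Nat.ModEq.eq_of_lt_of_lt h3 hr hr').symm
        rw [Nat.cast_pow, ← Padic.norm_int_le_pow_iff_dvd (p := p), not_le, zpow_neg,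
          zpow_natCast] at hnd
        rw [norm_mul, Padic.norm_p_zpow, neg_neg, zpow_natCast, pow_add]
        calc (p : ℝ) ^ N = ((p : ℝ) ^ j)⁻¹ * ((p : ℝ) ^ N * (p : ℝ) ^ j) := by field_simp
          _ < _ := mul_lt_mul_of_pos_right hnd (by positivity)
      convert lt_norm_sub_of_le_of_lt hz hlt using 2
      push_cast
      ring
    · intro h
      exact absurd (Finset.mem_range.2 hr) h
  · refine Finset.sum_eq_zero fun q _ => ?_
    have := lt_norm_sub_of_le_of_lt (hqn q) hz
    rw [norm_sub_rev] at this
    rw [hN _ this, mul_zero]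

/-- A refinement relation at a scale finer than the local constancy of `φ` makes the fine shifts
of `φ` linearly dependent. -/
theorem exists_fine_relation {φ : ℚ_[p] → ℂ} {N j : ℕ} (hne : ∃ x, φ x ≠ 0)
    (hper : ∀ x, φ (x - (p : ℚ_[p]) ^ ((j : ℤ) - N)) = φ x) {c : ℕ → ℂ}
    (hc : ∀ x, φ x = ∑ k ∈ Finset.range (p ^ (N + j)),
      c k * φ ((p : ℚ_[p]) ^ (-(j : ℤ)) * x
        - (k : ℚ_[p]) * (p : ℚ_[p]) ^ (-((N + j : ℕ) : ℤ)))) :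
    ∃ P : ℕ → ℂ, (∃ k < p ^ j * (p ^ N + 1), P k ≠ 0) ∧
      ∀ y, ∑ k ∈ Finset.range (p ^ j * (p ^ N + 1)),
        P k * φ (y - (k : ℚ_[p]) * (p : ℚ_[p]) ^ (-((N + j : ℕ) : ℤ))) = 0 := by
  have hp := prime_cast_padic_ne_zero (p := p)
  have hpj : 0 < p ^ j := pow_pos (Fact.out : p.Prime).pos j
  have hR : p ^ j * (p ^ N + 1) = p ^ j + p ^ (N + j) := by ring
  rw [hR]
  have hex : ∃ k, k < p ^ (N + j) ∧ c k ≠ 0 := by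
    by_contra! h
    obtain ⟨x, hx⟩ := hne
    refine hx ?_
    rw [hc x]
    exact Finset.sum_eq_zero fun k hk => by rw [h k (Finset.mem_range.1 hk), zero_mul]
  refine ⟨fun k => (if k < p ^ (N + j) then c k else 0)
    - (if p ^ j ≤ k then c (k - p ^ j) else 0), ⟨Nat.find hex, ?_, ?_⟩, fun y => ?_⟩
  · exact (Nat.find_spec hex).1.trans_le (Nat.le_add_left _ _)
  · have h1 := Nat.find_spec hex
    have h2 : (if p ^ j ≤ Nat.find hex then c (Nat.find hex - p ^ j) else 0) = 0 := by
      split_ifs with h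
      · have h3 := Nat.find_min hex (m := Nat.find hex - p ^ j) (by omega)
        by_contra h4
        exact h3 ⟨by omega, h4⟩
      · rfl
    simp only [h2, if_pos h1.1, sub_zero]
    exact h1.2
  · simp only [sub_mul, Finset.sum_sub_distrib]
    have hy : (p : ℚ_[p]) ^ (-(j : ℤ)) * ((p : ℚ_[p]) ^ (j : ℤ) * y) = y := by
      rw [← mul_assoc, ← zpow_add₀ hp]
      simp
    have e1 : ∑ k ∈ Finset.range (p ^ j + p ^ (N + j)), (if k < p ^ (N + j) then c k else 0)
        * φ (y - (k : ℚ_[p]) * (p : ℚ_[p]) ^ (-((N + j : ℕ) : ℤ)))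
        = φ ((p : ℚ_[p]) ^ (j : ℤ) * y) := by
      rw [hc, hy, add_comm, Finset.sum_range_add]
      rw [Finset.sum_eq_zero (s := Finset.range (p ^ j)), add_zero]
      · refine Finset.sum_congr rfl fun k hk => ?_
        rw [if_pos (Finset.mem_range.1 hk)]
      · intro k _
        rw [if_neg (by omega), zero_mul]
    have e2 : ∑ k ∈ Finset.range (p ^ j + p ^ (N + j)),
        (if p ^ j ≤ k then c (k - p ^ j) else 0)
        * φ (y - (k : ℚ_[p]) * (p : ℚ_[p]) ^ (-((N + j : ℕ) : ℤ)))
        = φ ((p : ℚ_[p]) ^ (j : ℤ) * y - (p : ℚ_[p]) ^ ((j : ℤ) - N)) := by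
      rw [hc, Finset.sum_range_add, Finset.sum_eq_zero (s := Finset.range (p ^ j)), zero_add]
      · refine Finset.sum_congr rfl fun k _ => ?_
        rw [if_pos (by omega), Nat.add_sub_cancel_left, mul_sub, hy, ← zpow_add₀ hp]
        congr 2
        have : ((p : ℚ_[p]) ^ j) * (p : ℚ_[p]) ^ (-((N + j : ℕ) : ℤ))
            = (p : ℚ_[p]) ^ (-(j : ℤ) + ((j : ℤ) - N)) := by
          rw [← zpow_natCast, ← zpow_add₀ hp]
          congr 1
          push_cast
          ring
        rw [← this]
        push_cast
        ring
      · intro k hk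
        rw [if_neg (by simpa using hk), zero_mul]
    rw [e1, e2, hper, sub_self]

/-- Orthonormality of the shifts by `I_p` turns a linear relation among the shifts
`φ(· - q p^{-N})`, `q ≤ p^N`, into invariance under translation by `1`. -/
theorem sub_one_eq_of_relation {φ : ℚ_[p] → ℂ} (hφ : Continuous φ) (hs : HasCompactSupport φ)
    (hmean : ∫ x, φ x ∂(padicHaar p) ≠ 0)
    (horth : ∀ a ∈ Ip p, ∀ b ∈ Ip p,
      ∫ x, φ (x - a) * (starRingEnd ℂ) (φ (x - b)) ∂(padicHaar p) = if a = b then 1 else 0)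
    {N : ℕ} {b : ℕ → ℂ} (hb : ∃ q < p ^ N + 1, b q ≠ 0)
    (hrel : ∀ z, ∑ q ∈ Finset.range (p ^ N + 1),
      b q * φ (z - (q : ℚ_[p]) * (p : ℚ_[p]) ^ (-(N : ℤ))) = 0) (x : ℚ_[p]) :
    φ (x - 1) = φ x := by
  have hp := prime_cast_padic_ne_zero (p := p)
  have hpN : 0 < p ^ N := pow_pos (Fact.out : p.Prime).pos N
  have hu : (p : ℚ_[p]) ^ (-(N : ℤ)) ≠ 0 := zpow_ne_zero _ hp
  set u := (p : ℚ_[p]) ^ (-(N : ℤ)) with hu_def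
  have hu1 : ((p ^ N : ℕ) : ℚ_[p]) * u = 1 := by
    rw [hu_def, zpow_neg, zpow_natCast, Nat.cast_pow]
    exact mul_inv_cancel₀ (pow_ne_zero _ hp)
  have hmem : ∀ q < p ^ N, (q : ℚ_[p]) * u ∈ Ip p := fun q hq => ⟨N, q, hq, rfl⟩
  have hint : ∀ a, Integrable (fun z => φ (z - a)) (padicHaar p) := fun a =>
    Continuous.integrable_of_hasCompactSupport (by fun_prop)
      (hs.comp_homeomorph (Homeomorph.subRight a))
  have hint2 : ∀ a a', Integrable (fun z => φ (z - a) * (starRingEnd ℂ) (φ (z - a')))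
      (padicHaar p) := fun a a' =>
    Continuous.integrable_of_hasCompactSupport (by fun_prop)
      (HasCompactSupport.mul_right (hs.comp_homeomorph (Homeomorph.subRight a)))
  have hlast : ∀ q, 0 < q → q < p ^ N →
      ∫ z, φ (z - ((p ^ N : ℕ) : ℚ_[p]) * u) * (starRingEnd ℂ) (φ (z - (q : ℚ_[p]) * u))
        ∂(padicHaar p) = 0 := by
    intro q hq0 hq
    have h0 : (0 : ℚ_[p]) ∈ Ip p := ⟨0, 0, by simp, by simp⟩
    have h1 := horth _ (hmem (p ^ N - q) (by omega)) 0 h0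
    rw [if_neg (mul_ne_zero (Nat.cast_ne_zero.2 (by omega)) hu),
      ← integral_sub_right_eq_self _ ((q : ℚ_[p]) * u)] at h1
    rw [← h1]
    refine integral_congr_ae (Filter.Eventually.of_forall fun z => ?_)
    simp only [sub_zero]
    congr 2
    rw [Nat.cast_sub hq.le]
    ring
  have hbz : ∀ q, 0 < q → q < p ^ N → b q = 0 := by
    intro q hq0 hq
    have h1 : ∫ z, ∑ i ∈ Finset.range (p ^ N + 1), b i * (φ (z - (i : ℚ_[p]) * u)
        * (starRingEnd ℂ) (φ (z - (q : ℚ_[p]) * u))) ∂(padicHaar p) = 0 := by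
      refine integral_eq_zero_of_ae (Filter.Eventually.of_forall fun z => ?_)
      simp only [← mul_assoc, ← Finset.sum_mul, hrel z, zero_mul, Pi.zero_apply]
    rw [integral_finsetSum _ fun i _ => (hint2 _ _).const_mul _] at h1
    simp only [integral_const_mul] at h1
    rw [Finset.sum_range_succ, hlast q hq0 hq, mul_zero, add_zero,
      Finset.sum_eq_single_of_mem q (Finset.mem_range.2 hq), horth _ (hmem q hq) _ (hmem q hq),
      if_pos rfl, mul_one] at h1
    · exact h1
    · intro i hi hne
      rw [horth _ (hmem i (Finset.mem_range.1 hi)) _ (hmem q hq), if_neg, mul_zero]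
      intro h
      exact hne (Nat.cast_injective (mul_right_cancel₀ hu h))
  have htwo : ∀ z, b 0 * φ z + b (p ^ N) * φ (z - 1) = 0 := by
    intro z
    rw [← hrel z, Finset.sum_range_succ, hu1,
      Finset.sum_eq_single_of_mem 0 (Finset.mem_range.2 hpN)]
    · simp
    · intro i hi hne
      rw [hbz i (Nat.pos_of_ne_zero hne) (Finset.mem_range.1 hi), zero_mul]
  have hsum : b 0 + b (p ^ N) = 0 := by
    have h1 : ∫ z, (b 0 * φ (z - 0) + b (p ^ N) * φ (z - 1)) ∂(padicHaar p) = 0 :=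
      integral_eq_zero_of_ae (Filter.Eventually.of_forall fun z => by simpa using htwo z)
    rw [integral_add ((hint 0).const_mul _) ((hint 1).const_mul _), integral_const_mul,
      integral_const_mul, integral_sub_right_eq_self φ, integral_sub_right_eq_self φ,
      ← add_mul] at h1
    exact (mul_eq_zero.1 h1).resolve_right hmean
  have hb0 : b 0 ≠ 0 := by
    intro h
    obtain ⟨q, hq, hbq⟩ := hb
    rcases Nat.eq_zero_or_pos q with rfl | hq0
    · exact hbq h
    rcases Nat.lt_succ_iff_lt_or_eq.1 hq with hq | rfl
    · exact hbq (hbz q hq0 hq)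
    · rw [h, zero_add] at hsum
      exact hbq hsum
  have h1 := htwo x
  rw [eq_neg_of_add_eq_zero_right hsum, neg_mul, ← sub_eq_add_neg, ← mul_sub] at h1
  exact (sub_eq_zero.1 ((mul_eq_zero.1 h1).resolve_left hb0)).symm

end Padic

/-- Any orthogonal test scaling function with nonzero mean is `1`-periodic:
if `φ` is a locally constant compactly supported function with `∫ φ ≠ 0` whose
translates `{φ(· - a) : a ∈ I_p}` are orthonormal and whose spaces `V_j(φ)` form
an MRA in `L²(ℚ_p)`, then `φ(x + y) = φ(x)` whenever `|y|_p ≤ 1`.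
(This is the translation-side form of `supp φ̂ ⊆ B_0(0)`.) -/
theorem stmt_14 (p : ℕ) [Fact p.Prime] (φ : ℚ_[p] → ℂ)
    (hlc : ∀ x : ℚ_[p], ∃ γ : ℤ, ∀ y : ℚ_[p], ‖y‖ ≤ (p : ℝ) ^ γ → φ (x + y) = φ x)
    (hcs : ∃ N : ℤ, ∀ x : ℚ_[p], (p : ℝ) ^ N < ‖x‖ → φ x = 0)
    (hmean : ∫ x, φ x ∂(padicHaar p) ≠ 0)
    (horth : ∀ a ∈ Ip p, ∀ b ∈ Ip p,
      ∫ x, φ (x - a) * (starRingEnd ℂ) (φ (x - b)) ∂(padicHaar p)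
        = if a = b then 1 else 0)
    (hmono : ∀ j : ℤ, Vspace p φ j ≤ Vspace p φ (j + 1))
    (hdense : Dense (⋃ j : ℤ, (Vspace p φ j : Set (Lp ℂ 2 (padicHaar p)))))
    (hinter : ⋂ j : ℤ, (Vspace p φ j : Set (Lp ℂ 2 (padicHaar p))) = {0})
    (hdilation : ∀ (j : ℤ) (f : Lp ℂ 2 (padicHaar p)),
      f ∈ Vspace p φ j ↔ ∃ g ∈ Vspace p φ (j + 1),
        (g : ℚ_[p] → ℂ) =ᵐ[padicHaar p] fun x => f ((p : ℚ_[p])⁻¹ * x)) :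
    ∀ x y : ℚ_[p], ‖y‖ ≤ 1 → φ (x + y) = φ x := by
  have hp := prime_cast_padic_ne_zero (p := p)
  have hp1 : (1 : ℝ) < p := one_lt_prime_cast
  have hp0 : (0 : ℝ) < p := zero_lt_one.trans hp1
  obtain ⟨N₀, hN₀⟩ := hcs
  have hN : ∀ x : ℚ_[p], (p : ℝ) ^ N₀.toNat < ‖x‖ → φ x = 0 := by
    intro x hx
    refine hN₀ x (lt_of_le_of_lt ?_ hx)
    rw [← zpow_natCast]
    exact zpow_le_zpow_right₀ hp1.le (Int.self_le_toNat N₀)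
  generalize N₀.toNat = N at hN
  obtain ⟨δ, hδ, hunif⟩ := exists_pos_forall_norm_lt_add_eq hlc hN
  have hφ := continuous_of_forall_norm_lt_add_eq hδ hunif
  have hs := hasCompactSupport_of_forall_lt_norm hN
  have hne : ∃ x, φ x ≠ 0 := by
    by_contra! h
    exact hmean (by simp [h])
  have hmem : ∀ j : ℕ, (hφ.memLp_of_hasCompactSupport hs).toLp φ ∈ Vspace p φ j := by
    intro j
    induction j with
    | zero =>
      refine Submodule.le_topologicalClosure _ 
        (Submodule.subset_span ⟨0, ⟨0, 0, by simp, by simp⟩, ?_⟩)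
      simpa using MemLp.coeFn_toLp (hφ.memLp_of_hasCompactSupport hs)
    | succ j ih =>
      have := hmono j ih
      exact_mod_cast this
  obtain ⟨j, hj⟩ : ∃ j : ℕ, ‖(p : ℚ_[p]) ^ ((j : ℤ) - N)‖ < δ := by
    have hp2 : (p : ℝ)⁻¹ < 1 := inv_lt_one_of_one_lt₀ hp1
    obtain ⟨j, hj⟩ := exists_pow_lt_of_lt_one (show 0 < δ / (p : ℝ) ^ N by positivity) hp2
    refine ⟨j, ?_⟩
    rw [lt_div_iff₀ (by positivity), inv_pow] at hj
    rw [Padic.norm_p_zpow, neg_sub, zpow_sub₀ hp0.ne', zpow_natCast, zpow_natCast, div_eq_inv_mul]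
    exact hj
  have hper : ∀ x, φ (x - (p : ℚ_[p]) ^ ((j : ℤ) - N)) = φ x := by
    intro x
    rw [sub_eq_add_neg]
    exact hunif x _ (by rwa [norm_neg])
  obtain ⟨c, hc⟩ := exists_sum_of_mem_Vspace hφ hN j (MemLp.coeFn_toLp _) (hmem j)
  obtain ⟨P, hP, hPrel⟩ := exists_fine_relation hne hper hc
  obtain ⟨b, hb, hbrel⟩ := exists_coarse_relation hN hP hPrel
  have hone := sub_one_eq_of_relation hφ hs hmean horth hb hbrel
  have hnat : ∀ (n : ℕ) (x : ℚ_[p]), φ (x + n) = φ x := by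
    intro n
    induction n with
    | zero => simp
    | succ n ih =>
      intro x
      rw [← hone, ← ih x]
      congr 1
      push_cast
      ring
  intro x y hy
  obtain ⟨z, rfl⟩ : ∃ z : ℤ_[p], (z : ℚ_[p]) = y := ⟨⟨y, hy⟩, rfl⟩
  obtain ⟨n, hn⟩ := PadicInt.denseRange_natCast.exists_dist_lt z hδ
  have h1 : ‖(z : ℚ_[p]) - n‖ < δ := by
    rw [dist_eq_norm, PadicInt.norm_def] at hn
    simpa using hn
  rw [← hnat n x, ← hunif (x + n) (z - n) h1]
  congr 1
  ring
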